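/- Let f ∈ C^{2n+1}_H(B) satisfy t_{2n+1} f = −f, and let u ∈ End(X)⊗B be an invertible H-invariant element with (u−1)² = 0, where X is a finite-dimensional right H-module. Then (Ψ^{2n+1} f)(ω ⊗ (u^{-1}−1) ⊗ (u−1) ⊗ ⋯ ⊗ (u^{-1}−1) ⊗ (u−1)) = 0 for every ω ∈ H. -/

import Mathlib

open scoped TensorProduct

noncomputable section

/-- A Hopf `ℂ`-algebra with invertible antipode, together with a chosen finite
(Sweedler) representation of the comultiplication: `Δ ω = ∑_{p ∈ Δl ω} p.1 ⊗ p.2`. -/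
structure HopfData (H : Type) [Ring H] [HopfAlgebra ℂ H] where
  /-- the inverse of the antipode -/
  Sinv : H →ₗ[ℂ] H
  Sinv_antipode : ∀ ω : H, Sinv (HopfAlgebra.antipode (R := ℂ) ω) = ω
  antipode_Sinv : ∀ ω : H, HopfAlgebra.antipode (R := ℂ) (Sinv ω) = ω
  /-- a chosen list representation of the comultiplication -/
  Δl : H → List (H × H)
  Δl_repr : ∀ ω : H,
    (Coalgebra.comul (R := ℂ) ω : H ⊗[ℂ] H) = ((Δl ω).map fun p => p.1 ⊗ₜ[ℂ] p.2).sum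

variable {H : Type} [Ring H] [HopfAlgebra ℂ H]

/-- the counit, as a `ℂ`-valued function -/
def epsi (ω : H) : ℂ := Coalgebra.counit (R := ℂ) ω

/-- Iterated Sweedler decomposition: `sw n ω` represents
`Δⁿ ω = ∑_v v 0 ⊗ ⋯ ⊗ v n`, where `Δⁿ = (ι ⊗ Δ) Δ^{n-1}`. -/
def HopfData.sw (D : HopfData H) : (n : ℕ) → H → List (Fin (n + 1) → H)
  | 0, ω => [fun _ => ω]
  | n + 1, ω =>
    (D.sw n ω).flatMap fun v =>
      (D.Δl (v (Fin.last n))).map fun p =>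
        Fin.snoc (Function.update v (Fin.last n) p.1) p.2

/-- A right `H`-module structure (over `ℂ`), recorded as the antihomomorphism
`act : H → End(B)`, so `act ω b` stands for `b ◁ ω`. -/
structure RAct (H : Type) [Ring H] [HopfAlgebra ℂ H] (B : Type) [AddCommGroup B]
    [Module ℂ B] where
  act : H →ₗ[ℂ] B →ₗ[ℂ] B
  act_one : act 1 = LinearMap.id
  act_mul : ∀ ω η : H, act (ω * η) = (act η) ∘ₗ (act ω)

/-- A unital right `H`-module algebra structure on `B`:
`(b₁ b₂) ◁ ω = ∑ (b₁ ◁ ω₍₀₎)(b₂ ◁ ω₍₁₎)` and `1 ◁ ω = ε(ω) 1`. -/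
structure MAlg (D : HopfData H) (B : Type) [Ring B] [Algebra ℂ B] extends RAct H B where
  act_mul_mul : ∀ (ω : H) (b₁ b₂ : B),
    act ω (b₁ * b₂) = ((D.Δl ω).map fun p => act p.1 b₁ * act p.2 b₂).sum
  act_algOne : ∀ ω : H, act ω (1 : B) = epsi ω • (1 : B)


/-- the action as a plain function: `fn ω b = b ◁ ω` -/
def RAct.fn {H : Type} [Ring H] [HopfAlgebra ℂ H] {B : Type} [AddCommGroup B] [Module ℂ B]
    (A : RAct H B) : H → B → B := fun ω x => A.act ω x

/-- the action of a module algebra as a plain function -/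
def MAlg.fn {H : Type} [Ring H] [HopfAlgebra ℂ H] {B : Type} [Ring B] [Algebra ℂ B]
    {D : HopfData H} (A : MAlg D B) : H → B → B := A.toRAct.fn

/-- The space of `ℂ`-valued functions of one `H`-variable and `n+1` `B`-variables;
(multi)linear such functions correspond to linear functionals on `H ⊗ B^{⊗(n+1)}`. -/
abbrev Raw (H B : Type) (n : ℕ) := H → (Fin (n + 1) → B) → ℂ

section Raw

variable {H : Type} [Ring H] [HopfAlgebra ℂ H] {B : Type} [Ring B] [Algebra ℂ B] {n : ℕ}

/-- `f` is linear in the `H`-variable and in each `B`-variable separately, i.e. `f`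
is (the restriction of) a linear functional on `H ⊗ B^{⊗(n+1)}`. -/
def IsML (f : Raw H B n) : Prop :=
  (∀ ω η b, f (ω + η) b = f ω b + f η b) ∧
  (∀ (c : ℂ) ω b, f (c • ω) b = c * f ω b) ∧
  (∀ ω b (i : Fin (n + 1)) (x y : B),
    f ω (Function.update b i (x + y)) =
      f ω (Function.update b i x) + f ω (Function.update b i y)) ∧
  (∀ ω b (i : Fin (n + 1)) (c : ℂ) (x : B),
    f ω (Function.update b i (c • x)) = c * f ω (Function.update b i x))

/-- `H`-invariance of the functional `f` on `H ⊗ B^{⊗(n+1)}`: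
`(ω ▷ f)(η ⊗ b₀ ⊗ ⋯ ⊗ bₙ) = f(S⁻¹(ω₍₀₎) η ω₍₁₎ ⊗ b₀ ◁ ω₍₂₎ ⊗ ⋯ ⊗ bₙ ◁ ω₍ₙ₊₂₎)`
equals `ε(ω) f(η ⊗ b₀ ⊗ ⋯ ⊗ bₙ)`. -/
def IsInv (D : HopfData H) (act : H → B → B) (f : Raw H B n) : Prop :=
  ∀ (ω η : H) (b : Fin (n + 1) → B),
    ((D.sw (n + 2) ω).map fun v =>
        f (D.Sinv (v 0) * η * v 1) fun i => act (v i.succ.succ) (b i)).sum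
      = epsi ω * f η b

/-- membership in the equivariant cochain space `C^n_H(B)` -/
def InC (D : HopfData H) (act : H → B → B) (f : Raw H B n) : Prop :=
  IsML f ∧ IsInv D act f

/-- the cyclic operator
`(tₙ f)(ω ⊗ b₀ ⊗ ⋯ ⊗ bₙ) = f(ω₍₀₎ ⊗ bₙ ◁ ω₍₁₎ ⊗ b₀ ⊗ ⋯ ⊗ b_{n-1})` -/
def tRaw (D : HopfData H) (act : H → B → B) (f : Raw H B n) : Raw H B n :=
  fun ω b =>
    ((D.Δl ω).map fun p =>
      f p.1 (Fin.cons (act p.2 (b (Fin.last n))) fun i : Fin n => b i.castSucc)).sum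

/-- merging the `i`-th and `(i+1)`-st entries of a `(n+2)`-tuple by multiplication -/
def contract (i : Fin (n + 1)) (b : Fin (n + 2) → B) : Fin (n + 1) → B :=
  fun j =>
    if (j : ℕ) < (i : ℕ) then b j.castSucc
    else if (j : ℕ) = (i : ℕ) then b j.castSucc * b j.succ
    else b j.succ

/-- the coface operators `dⁿᵢ : C^{n} → C^{n+1}` (`i < n+1` multiplies adjacent entries;
the last one is `d_{n+1} = t ∘ d₀`) -/
def dRaw (D : HopfData H) (act : H → B → B) (i : Fin (n + 2)) (f : Raw H B n) :
    Raw H B (n + 1) :=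
  if h : (i : ℕ) < n + 1 then fun ω b => f ω (contract ⟨i, h⟩ b)
  else tRaw D act fun ω b => f ω (contract 0 b)

/-- the codegeneracy operators `sⁿᵢ : C^{n+1} → C^n`, inserting a `1` after the `i`-th entry -/
def sRaw (i : Fin (n + 1)) (f : Raw H B (n + 1)) : Raw H B n :=
  fun ω b => f ω (Fin.insertNth i.succ 1 b)

/-- the Hochschild coboundary `b = ∑ (-1)ⁱ dᵢ` -/
def bRaw (D : HopfData H) (act : H → B → B) (f : Raw H B n) : Raw H B (n + 1) :=
  fun ω b => ∑ i : Fin (n + 2), ((-1 : ℂ) ^ (i : ℕ)) * dRaw D act i f ω b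

/-- cyclicity: `λ f = (-1)ⁿ tₙ f = f` -/
def IsCyc (D : HopfData H) (act : H → B → B) (f : Raw H B n) : Prop :=
  ∀ ω b, ((-1 : ℂ) ^ n) * tRaw D act f ω b = f ω b

/-- an `n`-cocycle of the cyclic complex `(Ker(1-λ), b)` computing `HC^n_H(B)` -/
def IsCocycle (D : HopfData H) (act : H → B → B) (f : Raw H B n) : Prop :=
  InC D act f ∧ IsCyc D act f ∧ ∀ ω b, bRaw D act f ω b = 0

end Raw

section Mat

variable {H : Type} [Ring H] [HopfAlgebra ℂ H]

/-- A finite-dimensional right `H`-module, presented as a matrix antirepresentation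
`π : H → Matrix ι ι ℂ` (so `x ◁ ω` is the row vector `x · π(ω)`). -/
structure MRep (H : Type) [Ring H] [HopfAlgebra ℂ H] (ι : Type) [Fintype ι]
    [DecidableEq ι] where
  π : H →ₗ[ℂ] Matrix ι ι ℂ
  π_one : π 1 = 1
  π_mul : ∀ ω η : H, π (ω * η) = π η * π ω

variable {B : Type} [Ring B] [Algebra ℂ B]
variable {ι κ : Type} [Fintype ι] [DecidableEq ι] [Fintype κ] [DecidableEq κ]

/-- The right `H`-action on `Hom(X, X') ⊗ B` (realized as rectangular matrices over `B`):
`(T ⊗ b) ◀ ω = π'(ω₍₀₎) T π(S⁻¹(ω₍₂₎)) ⊗ b ◁ ω₍₁₎`. -/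
def matActR (D : HopfData H) (P : MRep H ι) (P' : MRep H κ) (A : RAct H B) :
    H → Matrix κ ι B → Matrix κ ι B :=
  fun ω M =>
    ((D.sw 2 ω).map fun v =>
      ((P'.π (v 0)).map (algebraMap ℂ B)) *
        (M.map fun x => A.act (v 1) x) *
          ((P.π (D.Sinv (v 2))).map (algebraMap ℂ B))).sum

/-- the right `H`-action on `End(X) ⊗ B`, realized as `Matrix ι ι B` -/
def matAct (D : HopfData H) (P : MRep H ι) (A : RAct H B) :
    H → Matrix ι ι B → Matrix ι ι B :=
  matActR D P P A

/-- The map `Ψⁿ : C^n_H(B) → C^n_H(End(X) ⊗ B)`,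
`(Ψⁿ f)(ω ⊗ (T₀⊗b₀) ⊗ ⋯ ⊗ (Tₙ⊗bₙ)) = f(ω₍₀₎ ⊗ b₀ ⊗ ⋯ ⊗ bₙ) Tr(π(S⁻¹(ω₍₁₎)) T₀ ⋯ Tₙ)`,
written out on matrices over `B`. -/
def PsiRaw (D : HopfData H) (P : MRep H ι) {n : ℕ} (f : Raw H B n) :
    Raw H (Matrix ι ι B) n :=
  fun ω M =>
    ((D.Δl ω).map fun p =>
      ∑ k : Fin (n + 2) → ι,
        (P.π (D.Sinv p.2)) (k (Fin.last (n + 1))) (k 0) *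
          f p.1 fun i => M i (k i.castSucc) (k i.succ)).sum

/-- the right `H`-action on `X ⊗ B` (tensor product action), `X` realized as row
vectors with matrix antirepresentation `P` -/
def ractV (D : HopfData H) (P : MRep H ι) (A : RAct H B) (ω : H) (v : ι → B) : ι → B :=
  fun j => ((D.Δl ω).map fun p => ∑ i, (P.π p.1) i j • A.act p.2 (v i)).sum

/-- membership in `R(H)`, the `H`-invariant linear functionals on `H` (with the
adjoint action `η ◁ ω = S⁻¹(ω₍₀₎) η ω₍₁₎`) -/
def IsRH (D : HopfData H) (F : H → ℂ) : Prop :=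
  (∀ ω η : H, F (ω + η) = F ω + F η) ∧
  (∀ (c : ℂ) (ω : H), F (c • ω) = c * F ω) ∧
  (∀ ω η : H, ((D.Δl ω).map fun p => F (D.Sinv p.1 * η * p.2)).sum = epsi ω * F η)

end Mat

section Aux

variable {H : Type} [Ring H] [HopfAlgebra ℂ H]

/-- Sweedler sum -/
def ds (D : HopfData H) {M : Type} [AddCommMonoid M] (ω : H) (g : H → H → M) : M :=
  ∑ i : Fin (D.Δl ω).length, g ((D.Δl ω)[i]).1 ((D.Δl ω)[i]).2

theorem list_ds (D : HopfData H) {M : Type} [AddCommMonoid M] (ω : H) (g : H → H → M) :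
    ((D.Δl ω).map fun p => g p.1 p.2).sum = ds D ω g := by
  unfold ds
  exact (Fin.sum_univ_fun_getElem (D.Δl ω) (fun p => g p.1 p.2)).symm

theorem ds_comul (D : HopfData H) (ω : H) :
    (Coalgebra.comul (R := ℂ) ω : H ⊗[ℂ] H) = ds D ω fun a b => a ⊗ₜ[ℂ] b := by
  rw [D.Δl_repr, ← list_ds]

theorem ds_sum (D : HopfData H) {M : Type} [AddCommMonoid M] (ω : H) {κ : Type} (s : Finset κ)
    (g : κ → H → H → M) :
    ds D ω (fun a b => ∑ k ∈ s, g k a b) = ∑ k ∈ s, ds D ω (g k) := by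
  unfold ds
  exact Finset.sum_comm

theorem map_ds (D : HopfData H) {M N : Type} [AddCommMonoid M] [AddCommMonoid N]
    {Φ : Type} [FunLike Φ M N] [AddMonoidHomClass Φ M N] (φ : Φ) (ω : H) (g : H → H → M) :
    φ (ds D ω g) = ds D ω fun a b => φ (g a b) := by
  unfold ds
  exact map_sum _ _ _

theorem ds_lift (D : HopfData H) {M : Type} [AddCommMonoid M] [Module ℂ M]
    (G : H →ₗ[ℂ] H →ₗ[ℂ] M) (ω : H) :
    TensorProduct.lift G (Coalgebra.comul (R := ℂ) ω) = ds D ω fun a b => G a b := by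
  rw [ds_comul D, map_ds]
  simp

theorem ds_coassoc (D : HopfData H) {M N : Type} [AddCommMonoid M] [AddCommMonoid N]
    [Module ℂ M] [Module ℂ N] (F : H →ₗ[ℂ] M →ₗ[ℂ] N) (G : H →ₗ[ℂ] H →ₗ[ℂ] M) (ω : H) :
    ds D ω (fun a b => ds D a fun a' b' => F a' (G b' b)) =
      ds D ω (fun a b => F a (ds D b fun a' b' => G a' b')) := by
  have h := congrArg (TensorProduct.lift (F.compl₂ (TensorProduct.lift G)))
    (Coalgebra.coassoc_apply (R := ℂ) ω)
  have e1 : ∀ x : H ⊗[ℂ] H, TensorProduct.lift (F.compl₂ (TensorProduct.lift G))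
      (LinearMap.lTensor H (Coalgebra.comul (R := ℂ)) x) =
      TensorProduct.lift (F.compl₂ (TensorProduct.lift G ∘ₗ Coalgebra.comul (R := ℂ))) x := by
    intro x
    induction x with
    | zero => simp
    | tmul a b => simp
    | add x y hx hy => simp only [map_add, hx, hy]
  rw [e1, ds_lift D] at h
  rw [ds_comul D, map_ds, map_ds, map_ds] at h
  simp only [LinearMap.rTensor_tmul, LinearMap.compl₂_apply, LinearMap.comp_apply, ds_lift D] at h
  rw [← h]
  congr 1
  funext a b
  rw [ds_comul D]
  unfold ds
  rw [TensorProduct.sum_tmul, map_sum, map_sum]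
  simp

theorem ds_counit_left (D : HopfData H) {M : Type} [AddCommMonoid M] [Module ℂ M]
    (φ : H →ₗ[ℂ] M) (ω : H) :
    ds D ω (fun a b => epsi a • φ b) = φ ω := by
  have h := congrArg (TensorProduct.lift (LinearMap.lsmul ℂ H))
    (Coalgebra.rTensor_counit_comul (R := ℂ) ω)
  rw [ds_comul D, map_ds, map_ds] at h
  simp only [LinearMap.rTensor_tmul, TensorProduct.lift.tmul, LinearMap.lsmul_apply, one_smul] at h
  conv_rhs => rw [← h]
  rw [map_ds]
  simp [epsi]

theorem ds_counit_right (D : HopfData H) {M : Type} [AddCommMonoid M] [Module ℂ M]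
    (φ : H →ₗ[ℂ] M) (ω : H) :
    ds D ω (fun a b => epsi b • φ a) = φ ω := by
  have h := congrArg (TensorProduct.lift (LinearMap.lsmul ℂ H).flip)
    (Coalgebra.lTensor_counit_comul (R := ℂ) ω)
  rw [ds_comul D, map_ds, map_ds] at h
  simp only [LinearMap.lTensor_tmul, TensorProduct.lift.tmul, LinearMap.lsmul_apply, one_smul,
    LinearMap.flip_apply] at h
  conv_rhs => rw [← h]
  rw [map_ds]
  simp [epsi]

theorem ds_Sinv (D : HopfData H) (ω : H) :
    ds D ω (fun a b => b * D.Sinv a) = epsi ω • (1 : H) := by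
  have key : HopfAlgebra.antipode ℂ (ds D ω (fun a b => b * D.Sinv a)) =
      HopfAlgebra.antipode ℂ (epsi ω • (1 : H)) := by
    rw [map_ds, map_smul, HopfAlgebra.antipode_one]
    simp only [HopfAlgebra.antipode_mul_antidistrib, D.antipode_Sinv]
    have h := HopfAlgebra.mul_antipode_lTensor_comul_apply (R := ℂ) ω
    rw [ds_comul D, map_ds, map_ds] at h
    simpa [epsi, Algebra.smul_def] using h
  have := congrArg D.Sinv key
  rwa [D.Sinv_antipode, D.Sinv_antipode] at this

theorem list_sum_flatMap {α β M : Type} [AddCommMonoid M] (l : List α) (h : α → List β)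
    (g : β → M) : ((l.flatMap h).map g).sum = (l.map fun a => ((h a).map g).sum).sum := by
  induction l with
  | nil => simp
  | cons a l ih => simp [List.flatMap_cons, ih]

theorem sw_two (D : HopfData H) {M : Type} [AddCommMonoid M] (ω : H) (g : H → H → H → M) :
    ((D.sw 2 ω).map fun v => g (v 0) (v 1) (v 2)).sum =
      ds D ω fun a b => ds D b fun a' b' => g a a' b' := by
  simp only [← list_ds]
  simp only [HopfData.sw, list_sum_flatMap, List.map_map, List.map_cons, List.map_nil,
    List.sum_cons, List.sum_nil, add_zero]
  rfl

variable {B : Type} [Ring B] [Algebra ℂ B] {ι : Type} [Fintype ι] [DecidableEq ι]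

/-- scalar matrices inside matrices over `B` -/
def rho (P : MRep H ι) : H →ₗ[ℂ] Matrix ι ι B :=
  (Algebra.ofId ℂ B).mapMatrix.toLinearMap ∘ₗ P.π

theorem rho_apply (P : MRep H ι) (h : H) :
    (rho P h : Matrix ι ι B) = (P.π h).map (algebraMap ℂ B) := rfl

theorem rho_mul (P : MRep H ι) (a b : H) :
    (rho P a * rho P b : Matrix ι ι B) = rho P (b * a) := by
  simp [rho, P.π_mul]

theorem rho_one (P : MRep H ι) : (rho P 1 : Matrix ι ι B) = 1 := by
  simp [rho, P.π_one]

/-- entrywise action -/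
def actM (A : RAct H B) (u : Matrix ι ι B) : H →ₗ[ℂ] Matrix ι ι B where
  toFun h := u.map fun x => A.act h x
  map_add' a b := by ext; simp
  map_smul' a b := by ext; simp

/-- `u` is quasi-invariant -/
def QInv (D : HopfData H) (P : MRep H ι) (A : RAct H B) (u : Matrix ι ι B) : Prop :=
  ∀ ω : H, ds D ω (fun a b => actM A u a * rho P (D.Sinv b)) = rho P (D.Sinv ω) * u

theorem qinv_sub (D : HopfData H) (P : MRep H ι) (A : RAct H B) (u v : Matrix ι ι B)
    (hu : QInv D P A u) (hv : QInv D P A v) : QInv D P A (u - v) := by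
  intro ω
  rw [mul_sub, ← hu, ← hv]
  unfold ds
  rw [← Finset.sum_sub_distrib]
  refine Finset.sum_congr rfl fun i _ => ?_
  beta_reduce
  rw [← sub_mul]
  have : ∀ a, actM A (u - v) a = actM A u a - actM A v a := by
    intro a
    ext
    simp [actM]
  rw [this]

theorem qinv_one (D : HopfData H) (P : MRep H ι) (A : MAlg D B) :
    QInv D P A.toRAct (1 : Matrix ι ι B) := by
  intro ω
  rw [mul_one]
  have : ∀ a, actM A.toRAct (1 : Matrix ι ι B) a = epsi a • (1 : Matrix ι ι B) := by
    intro a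
    ext i j
    by_cases h : i = j
    · subst h; simp [actM, A.act_algOne]
    · simp [actM, h]
  simp only [this, smul_mul_assoc, one_mul]
  exact ds_counit_left D (rho P ∘ₗ D.Sinv) ω

theorem qinv_of_inv (D : HopfData H) (P : MRep H ι) (A : RAct H B) (u : Matrix ι ι B)
    (hinv : ∀ ω : H, matAct D P A ω u = epsi ω • u) : QInv D P A u := by
  let R := Matrix ι ι B
  let β : H →ₗ[ℂ] H →ₗ[ℂ] R :=
    (LinearMap.mul ℂ R).compl₁₂ (actM A u) (rho P ∘ₗ D.Sinv)
  let L : H →ₗ[ℂ] R := TensorProduct.lift β ∘ₗ Coalgebra.comul (R := ℂ)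
  have hL : ∀ ω, L ω = ds D ω (fun a b => actM A u a * rho P (D.Sinv b)) := fun ω =>
    ds_lift D β ω
  have hm : ∀ ω, ds D ω (fun a b => rho P a * L b) = epsi ω • u := by
    intro ω
    rw [← hinv ω]
    unfold matAct matActR
    rw [sw_two D ω (fun a b c => ((P.π a).map (algebraMap ℂ B)) *
        (u.map fun x => A.act b x) * ((P.π (D.Sinv c)).map (algebraMap ℂ B)))]
    congr 1
    funext a b
    rw [hL]
    unfold ds
    rw [Finset.mul_sum]
    refine Finset.sum_congr rfl fun i _ => ?_
    rw [← mul_assoc]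
    rfl
  intro ω
  rw [← hL, ← ds_counit_left D L ω]
  have e : ∀ a b, epsi a • L b = ds D a fun a' b' => rho P (D.Sinv a') * (rho P b' * L b) := by
    intro a b
    have h1 := congrArg (rho P (B := B)) (ds_Sinv D a)
    rw [map_ds, map_smul, rho_one] at h1
    have h2 := congrArg (· * L b) h1
    simp only [smul_mul_assoc, one_mul] at h2
    rw [← h2]
    unfold ds
    rw [Finset.sum_mul]
    refine Finset.sum_congr rfl fun i _ => ?_
    beta_reduce
    rw [← mul_assoc, rho_mul]
  simp only [e]
  have := ds_coassoc D ((LinearMap.mul ℂ R) ∘ₗ (rho P ∘ₗ D.Sinv))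
    ((LinearMap.mul ℂ R).compl₁₂ (rho P) L) ω
  refine this.trans ?_
  have h3 : ∀ a b, ((LinearMap.mul ℂ R) ∘ₗ (rho P ∘ₗ D.Sinv)) a
      (ds D b fun a' b' => ((LinearMap.mul ℂ R).compl₁₂ (rho P) L) a' b') =
      epsi b • (rho P (D.Sinv a) * u) := by
    intro a b
    have := hm b
    simp only [LinearMap.compl₁₂_apply, LinearMap.mul_apply', LinearMap.comp_apply]
    rw [this, mul_smul_comm]
  simp only [h3]
  exact ds_counit_right D ((LinearMap.mulRight ℂ u) ∘ₗ rho P ∘ₗ D.Sinv) ω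

theorem qinv_entry (D : HopfData H) (P : MRep H ι) (A : RAct H B) (x : Matrix ι ι B)
    (hx : QInv D P A x) (ω : H) (i j : ι) :
    (∑ l, ds D ω (fun a b => P.π (D.Sinv b) l j • A.act a (x i l))) =
      ∑ l, P.π (D.Sinv ω) i l • x l j := by
  have h := congrFun (congrFun (hx ω) i) j
  rw [Matrix.mul_apply] at h
  rw [← ds_sum]
  have e : ∀ l, P.π (D.Sinv ω) i l • x l j = (rho P (D.Sinv ω)) i l * x l j := by
    intro l; rw [rho_apply, Matrix.map_apply, Algebra.smul_def]
  simp only [e]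
  rw [← h]
  unfold ds
  rw [Matrix.sum_apply]
  refine Finset.sum_congr rfl fun i _ => ?_
  beta_reduce
  rw [Matrix.mul_apply]
  refine Finset.sum_congr rfl fun i _ => ?_
  rw [rho_apply, Matrix.map_apply, Algebra.smul_def, Algebra.commutes]
  rfl

/-- `f` with the last entries frozen -/
def fslot {n : ℕ} (f : Raw H B n) (hf : IsML f) (t : Fin n → B) : H →ₗ[ℂ] B →ₗ[ℂ] ℂ :=
  LinearMap.mk₂ ℂ (fun h b => f h (Fin.cons b t))
    (fun a b c => hf.1 _ _ _) (fun c a b => hf.2.1 _ _ _)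
    (fun a b c => by
      have := hf.2.2.1 a (Fin.cons 0 t) 0 b c
      simpa only [Fin.update_cons_zero] using this)
    (fun c a b => by
      have := hf.2.2.2 a (Fin.cons 0 t) 0 c b
      simpa only [Fin.update_cons_zero, smul_eq_mul] using this)

theorem psi_t (D : HopfData H) (P : MRep H ι) (A : MAlg D B) {n : ℕ} (f : Raw H B n)
    (hf : IsML f) (x : Matrix ι ι B) (hx : QInv D P A.toRAct x) (ω : H) :
    PsiRaw D P (tRaw D A.fn f) ω (fun _ => x) = PsiRaw D P f ω (fun _ => x) := by
  unfold PsiRaw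
  rw [list_ds D ω (fun a b => ∑ k : Fin (n + 2) → ι, (P.π (D.Sinv b)) (k (Fin.last (n + 1))) (k 0) *
      tRaw D A.fn f a fun i => x (k i.castSucc) (k i.succ)),
    list_ds D ω (fun a b => ∑ k : Fin (n + 2) → ι, (P.π (D.Sinv b)) (k (Fin.last (n + 1))) (k 0) *
      f a fun i => x (k i.castSucc) (k i.succ))]
  let tl : (Fin (n + 1) → ι) → Fin n → B := fun k i => x (k i.castSucc) (k i.succ)
  let F : (Fin (n + 1) → ι) → H →ₗ[ℂ] B →ₗ[ℂ] ℂ := fun k => fslot f hf (tl k)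
  let ev : ι → ι → (Matrix ι ι ℂ →ₗ[ℂ] ℂ) := fun i j => Matrix.entryLinearMap ℂ ℂ i j
  let G : (Fin (n + 1) → ι) → ι → H →ₗ[ℂ] H →ₗ[ℂ] B := fun k l =>
    (LinearMap.lsmul ℂ B).flip.compl₁₂ (A.act.flip (x (k (Fin.last n)) l))
      (ev l (k 0) ∘ₗ P.π ∘ₗ D.Sinv)
  have hG : ∀ k l a b, G k l a b = P.π (D.Sinv b) l (k 0) • A.act a (x (k (Fin.last n)) l) :=
    fun k l a b => rfl
  have hF : ∀ k a b, F k a b = f a (Fin.cons b (tl k)) := fun k a b => rfl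
  -- left-hand side
  have hl : ∀ a b, (∑ k : Fin (n + 2) → ι, (P.π (D.Sinv b)) (k (Fin.last (n + 1))) (k 0) *
      tRaw D A.fn f a fun i => x (k i.castSucc) (k i.succ)) =
      ∑ k : Fin (n + 1) → ι, ∑ l : ι, ds D a fun a' b' => F k a' (G k l b' b) := by
    intro a b
    rw [← (Fin.snocEquiv (fun _ : Fin (n + 2) => ι)).sum_comp, Fintype.sum_prod_type,
      Finset.sum_comm]
    refine Finset.sum_congr rfl fun k _ => Finset.sum_congr rfl fun l _ => ?_
    unfold tRaw
    rw [list_ds D a (fun c d => f c (Fin.cons (A.fn d _) _))]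
    unfold ds
    rw [Finset.mul_sum]
    refine Finset.sum_congr rfl fun i _ => ?_
    beta_reduce
    rw [hG, map_smul, hF, smul_eq_mul]
    have e1 : ∀ i : Fin (n + 1), (Fin.snocEquiv fun _ : Fin (n + 2) => ι) (l, k) i.castSucc = k i :=
      fun i => Fin.snoc_castSucc (α := fun _ => ι) l k i
    have e2 : (Fin.snocEquiv fun _ : Fin (n + 2) => ι) (l, k) (Fin.last (n + 1)) = l :=
      Fin.snoc_last (α := fun _ => ι) l k
    have e3 : (Fin.snocEquiv fun _ : Fin (n + 2) => ι) (l, k) 0 = k 0 := e1 0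
    have e4 : ∀ i : Fin n, (Fin.snocEquiv fun _ : Fin (n + 2) => ι) (l, k) i.castSucc.succ =
      k i.succ := fun i => e1 i.succ
    simp only [e1, e2, e3, e4, Fin.succ_last]
    rfl
  have hr : ∀ a b, (∑ k : Fin (n + 2) → ι, (P.π (D.Sinv b)) (k (Fin.last (n + 1))) (k 0) *
      f a fun i => x (k i.castSucc) (k i.succ)) =
      ∑ k : Fin (n + 1) → ι, F k a (∑ l : ι, P.π (D.Sinv b) (k (Fin.last n)) l • x l (k 0)) := by
    intro a b
    rw [← (Fin.consEquiv (fun _ : Fin (n + 2) => ι)).sum_comp, Fintype.sum_prod_type,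
      Finset.sum_comm]
    refine Finset.sum_congr rfl fun k _ => ?_
    rw [map_sum]
    refine Finset.sum_congr rfl fun l _ => ?_
    rw [map_smul, hF, smul_eq_mul]
    congr 2
    funext i
    refine Fin.cases rfl (fun j => rfl) i
  simp only [hl, hr, ds_sum]
  refine Finset.sum_congr rfl fun k _ => ?_
  simp only [ds_coassoc]
  rw [← ds_sum]
  congr 1
  funext a b
  rw [← map_sum]
  simp only [hG]
  rw [qinv_entry D P A.toRAct x hx]

theorem ml_signs {n : ℕ} (f : Raw H B n) (hf : IsML f) (ω : H) (s : Fin (n + 1) → ℂ)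
    (b : Fin (n + 1) → B) :
    f ω (fun i => s i • b i) = (∏ i, s i) * f ω b := by
  let g : MultilinearMap ℂ (fun _ : Fin (n + 1) => B) ℂ :=
    { toFun := f ω
      map_update_add' := by
        intro inst m i a c
        rw [Subsingleton.elim inst (instDecidableEqFin (n + 1))]
        exact hf.2.2.1 ω m i a c
      map_update_smul' := by
        intro inst m i c a
        rw [Subsingleton.elim inst (instDecidableEqFin (n + 1))]
        exact hf.2.2.2 ω m i c a }
  exact g.map_smul_univ s b

end Aux

/-- if `f ∈ C^{2n+1}_H(B)` satisfies `t_{2n+1} f = -f` and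
`u ∈ End(X) ⊗ B` is an invertible `H`-invariant element with `(u-1)² = 0`, then
`(Ψ^{2n+1} f)(ω ⊗ (u⁻¹-1) ⊗ (u-1) ⊗ ⋯ ⊗ (u⁻¹-1) ⊗ (u-1)) = 0`. -/
theorem odd_pairing_vanishes_on_unipotent
    {H : Type} [Ring H] [HopfAlgebra ℂ H] (D : HopfData H)
    {B : Type} [Ring B] [Algebra ℂ B] (A : MAlg D B)
    (n : ℕ) (f : Raw H B (2 * n + 1)) (hf : InC D A.fn f)
    (hskew : ∀ ω b, tRaw D A.fn f ω b = - f ω b)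
    (ι : Type) [Fintype ι] [DecidableEq ι] (P : MRep H ι)
    (u u' : Matrix ι ι B) (huu' : u * u' = 1) (hu'u : u' * u = 1)
    (hinv : ∀ ω : H, matAct D P A.toRAct ω u = epsi ω • u)
    (hsq : (u - 1) * (u - 1) = 0) :
    ∀ ω : H,
      PsiRaw D P f ω (fun i => if (i : ℕ) % 2 = 0 then u' - 1 else u - 1) = 0 := by
  intro ω
  have hu' : u' - 1 = -(u - 1) := by
    have h1 : u * (2 - u) = 1 := by
      have : u * (2 - u) = 1 - (u - 1) * (u - 1) := by noncomm_ring
      rw [this, hsq, sub_zero]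
    have h2 : u' = 2 - u := by
      calc u' = u' * (u * (2 - u)) := by rw [h1, mul_one]
        _ = 2 - u := by rw [← mul_assoc, hu'u, one_mul]
    rw [h2, ← one_add_one_eq_two]
    abel
  have hq : QInv D P A.toRAct (u - 1) :=
    qinv_sub D P _ _ _ (qinv_of_inv D P _ _ hinv) (qinv_one D P A)
  have hz : PsiRaw D P f ω (fun _ => u - 1) = 0 := by
    have h := psi_t D P A f hf.1 (u - 1) hq ω
    have e : tRaw D A.fn f = fun ω b => - f ω b := by
      funext ω b
      exact hskew ω b
    rw [e] at h
    have h2 : PsiRaw D P (fun ω b => - f ω b) ω (fun _ => u - 1) =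
        - PsiRaw D P f ω (fun _ => u - 1) := by
      unfold PsiRaw
      simp only [mul_neg, Finset.sum_neg_distrib]
      generalize D.Δl ω = l
      induction l with
      | nil => simp
      | cons a l ih => simp only [List.map_cons, List.sum_cons, ih, neg_add]
    rw [h2] at h
    exact self_eq_neg.mp h.symm
  let s : Fin (2 * n + 1 + 1) → ℂ := fun i => if (i : ℕ) % 2 = 0 then -1 else 1
  have hs : PsiRaw D P f ω (fun i => if (i : ℕ) % 2 = 0 then u' - 1 else u - 1) =
      (∏ i, s i) * PsiRaw D P f ω (fun _ => u - 1) := by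
    unfold PsiRaw
    rw [← List.sum_map_mul_left]
    congr 1
    refine List.map_congr_left fun p _ => ?_
    rw [Finset.mul_sum]
    refine Finset.sum_congr rfl fun k _ => ?_
    rw [mul_left_comm, ← ml_signs f hf.1]
    congr 2
    funext i
    by_cases h : (i : ℕ) % 2 = 0
    · simp only [s, h, if_true, hu', neg_smul, one_smul, Matrix.neg_apply]
    · simp [s, h]
  rw [hs, hz, mul_zero]

end
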